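/- If T is a tree with at least two vertices and v is a leaf of T (a vertex of degree 1), then bdim(T − v) ≤ bdim(T), where T − v denotes the subgraph of T induced on V(T) \ {v}. -/

import Mathlib

open SimpleGraph

/-- `f` is a resolving broadcast of `G`: for any two distinct vertices `x, y` there is a
vertex `z` with `f z > 0` such that `min (d(x,z)) (f z + 1) ≠ min (d(y,z)) (f z + 1)`,
where distances are extended naturals (`⊤` for vertices in different components). -/
def IsResolvingBroadcast {V : Type*} (G : SimpleGraph V) (f : V → ℕ) : Prop :=
  ∀ x y : V, x ≠ y → ∃ z : V, 0 < f z ∧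
    min (G.edist x z) ((f z : ℕ∞) + 1) ≠ min (G.edist y z) ((f z : ℕ∞) + 1)

/-- The broadcast dimension of `G`: the minimum of `∑ v, f v` over all
resolving broadcasts `f` of `G`. -/
noncomputable def bdim {V : Type*} [Fintype V] (G : SimpleGraph V) : ℕ :=
  sInf {n : ℕ | ∃ f : V → ℕ, IsResolvingBroadcast G f ∧ ∑ v, f v = n}

theorem SimpleGraph.Walk.edist_induce_le_length {V : Type*} {G : SimpleGraph V} {s : Set V}
    (r : V → s) (hr : ∀ a b, G.Adj a b → (G.induce s).edist (r a) (r b) ≤ 1) {x y : V}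
    (p : G.Walk x y) : (G.induce s).edist (r x) (r y) ≤ p.length := by
  induction p with
  | nil => simp
  | cons h p ih =>
    refine SimpleGraph.edist_triangle.trans ((add_le_add (hr _ _ h) ih).trans ?_)
    rw [Walk.length_cons, Nat.cast_add, Nat.cast_one, add_comm]

theorem SimpleGraph.edist_le_edist_induce {V : Type*} {G : SimpleGraph V} {s : Set V} (x y : s) :
    G.edist x y ≤ (G.induce s).edist x y :=
  le_iInf fun p =>
    (edist_le (p.map (Embedding.induce s).toHom)).trans_eq (by rw [Walk.length_map])

/-- Deleting a vertex with a unique neighbour preserves all distances. -/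
theorem SimpleGraph.edist_induce_ne_of_adj_iff {V : Type*} {G : SimpleGraph V} {u v : V}
    (huv : ∀ w, G.Adj v w ↔ w = u) (x y : {w : V | w ≠ v}) :
    (G.induce {w : V | w ≠ v}).edist x y = G.edist x y := by
  classical
  have hu : u ≠ v := ((huv u).2 rfl).ne'
  let r : V → {w : V | w ≠ v} := fun w => if h : w = v then ⟨u, hu⟩ else ⟨w, h⟩
  have hrx (w : {w : V | w ≠ v}) : r w = w := dif_neg w.2
  refine le_antisymm (le_iInf fun p => ?_) (edist_le_edist_induce x y)
  have hr : ∀ a b, G.Adj a b → (G.induce {w : V | w ≠ v}).edist (r a) (r b) ≤ 1 := by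
    intro a b hab
    by_cases ha : a = v
    · subst ha
      obtain rfl := (huv b).1 hab
      simp [r, hu]
    by_cases hb : b = v
    · subst hb
      obtain rfl := (huv a).1 hab.symm
      simp [r, hu]
    · refine (edist_eq_one_iff_adj.2 ?_).le
      simpa [r, ha, hb] using hab
  simpa only [hrx] using p.edist_induce_le_length r hr

theorem SimpleGraph.edist_eq_edist_add_one_of_adj_iff {V : Type*} {G : SimpleGraph V} {u v : V}
    (huv : ∀ w, G.Adj v w ↔ w = u) {x : V} (hx : x ≠ v) :
    G.edist x v = G.edist x u + 1 := by
  have h1 : G.edist u v = 1 := edist_eq_one_iff_adj.2 ((huv u).2 rfl).symm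
  refine le_antisymm (SimpleGraph.edist_triangle.trans_eq (by rw [h1])) ?_
  rw [G.edist_comm (u := x), G.edist_comm (u := x)]
  refine le_iInf fun p => ?_
  cases p with
  | nil => exact absurd rfl hx
  | cons h p =>
    obtain rfl := (huv _).1 h
    rw [Walk.length_cons, Nat.cast_add, Nat.cast_one]
    gcongr
    exact edist_le p

theorem min_eq_min_of_le {α : Type*} [LinearOrder α] {a b m n : α} (hmn : m ≤ n)
    (h : min a n = min b n) : min a m = min b m := by
  rw [← min_eq_right hmn, ← min_assoc, ← min_assoc, h]

theorem isResolvingBroadcast_one {V : Type*} (G : SimpleGraph V) :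
    IsResolvingBroadcast G fun _ => 1 := by
  refine fun x y hxy => ⟨x, one_pos, fun h => hxy ?_⟩
  rw [edist_self, min_eq_left zero_le, eq_comm, min_eq_iff] at h
  rcases h with h | h
  · exact (edist_eq_zero_iff.1 h.1).symm
  · simp at h

/-- The broadcast of a deleted vertex can be taken over by its unique neighbour. -/
theorem IsResolvingBroadcast.induce_ne {V : Type*} [DecidableEq V] {G : SimpleGraph V} {u v : V}
    {f : V → ℕ} (hf : IsResolvingBroadcast G f) (huv : ∀ w, G.Adj v w ↔ w = u) :
    IsResolvingBroadcast (G.induce {w : V | w ≠ v})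
      fun w => f w + if (w : V) = u then f v else 0 := by
  intro x y hxy
  obtain ⟨z, hz, hne⟩ := hf x y (Subtype.coe_injective.ne hxy)
  by_cases hzv : z = v
  · subst hzv
    refine ⟨⟨u, ((huv u).2 rfl).ne'⟩, by simpa using Or.inr hz, fun h => hne ?_⟩
    rw [edist_induce_ne_of_adj_iff huv, edist_induce_ne_of_adj_iff huv] at h
    rw [edist_eq_edist_add_one_of_adj_iff huv x.2, edist_eq_edist_add_one_of_adj_iff huv y.2,
      min_add_add_right, min_add_add_right]
    congr 1
    refine min_eq_min_of_le ?_ h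
    simp only [if_true]
    exact_mod_cast show f z ≤ f u + f z + 1 by lia
  · refine ⟨⟨z, hzv⟩, by positivity, fun h => hne ?_⟩
    rw [edist_induce_ne_of_adj_iff huv, edist_induce_ne_of_adj_iff huv] at h
    refine min_eq_min_of_le ?_ h
    gcongr
    exact Nat.le_add_right _ _

/-- If `T` is a tree with at least two vertices and `v` is a leaf of `T`, then
deleting `v` does not increase the broadcast dimension. -/
theorem bdim_delete_leaf_le {V : Type*} [Fintype V] [DecidableEq V]
    (T : SimpleGraph V) [DecidableRel T.Adj] (hT : T.IsTree)
    (hn : 2 ≤ Fintype.card V) (v : V) (hv : T.degree v = 1) :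
    bdim (T.induce {w : V | w ≠ v}) ≤ bdim T := by
  obtain ⟨u, hu, huniq⟩ := degree_eq_one_iff_existsUnique_adj.1 hv
  have huv : ∀ w, T.Adj v w ↔ w = u := fun w => ⟨huniq w, fun h => h ▸ hu⟩
  obtain ⟨f, hf, hsum⟩ := Nat.sInf_mem (s := {n : ℕ | ∃ f : V → ℕ,
    IsResolvingBroadcast T f ∧ ∑ v, f v = n}) ⟨_, _, isResolvingBroadcast_one T, rfl⟩
  refine le_of_le_of_eq (Nat.sInf_le ⟨_, hf.induce_ne huv, rfl⟩) (Eq.trans ?_ hsum)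
  have hsub (g : V → ℕ) : ∑ w : {w : V | w ≠ v}, g w = ∑ w ∈ Finset.univ.erase v, g w :=
    (Finset.sum_subtype _ (by simp) g).symm
  rw [hsub fun w => f w + if w = u then f v else 0, Finset.sum_add_distrib,
    Finset.sum_ite_eq', if_pos (by simpa using hu.ne'), Finset.sum_erase_add _ _ (Finset.mem_univ v)]
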